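/- arXiv:1907.00203 — 5 statements merged into one kernel-verified Lean document; each statement's English description precedes it below -/
import Mathlib

section
/- Let A and B be finite sets, and let c_sub : A × B → ℝ≥0, c_del : A → ℝ≥0, c_ins : B → ℝ≥0 be cost functions satisfying the quasimetric condition c_sub(a,b) ≤ c_del(a) + c_ins(b) for all a ∈ A and b ∈ B. Suppose |A| ≤ |B|. Then for every error-correcting assignment π between A and B there exists an error-correcting assignment π' between A and B that deletes no element of A (i.e., every element of A is substituted by some element of B) and satisfies cost(π') ≤ cost(π). -/
/-- An error-correcting assignment (feasible LSAPE solution) between `A` and `B`: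
a function `π : A → Option B` (where `none` plays the role of `ε`) that is injective
on the preimage of `B`. -/
def IsECA {A B : Type*} (π : A → Option B) : Prop :=
  ∀ a a' : A, ∀ b : B, π a = some b → π a' = some b → a = a'

/-- The cost of an error-correcting assignment `π`: substitution costs of substituted
elements, plus deletion costs of deleted elements, plus insertion costs of the
elements of `B` not in the image of `π`. -/
noncomputable def ecaCost {A B : Type*} [Fintype A] [Fintype B] [DecidableEq B]
    (csub : A → B → NNReal) (cdel : A → NNReal) (cins : B → NNReal)
    (π : A → Option B) : NNReal :=
  (∑ a : A, (π a).elim (cdel a) (fun b => csub a b)) +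
    ∑ b ∈ Finset.univ.filter (fun b => ∀ a, π a ≠ some b), cins b

theorem IsECA.update_some {A B : Type*} [DecidableEq A] {π : A → Option B} (hπ : IsECA π)
    (a : A) {b : B} (hb : ∀ a', π a' ≠ some b) :
    IsECA (Function.update π a (some b)) := by
  intro x y c hx hy
  by_cases hxa : x = a <;> by_cases hya : y = a
  · rw [hxa, hya]
  · subst hxa
    simp only [Function.update_self, Option.some.injEq, Function.update_of_ne hya] at hx hy
    exact absurd (hx ▸ hy) (hb y)
  · subst hya
    simp only [Function.update_self, Option.some.injEq, Function.update_of_ne hxa] at hx hy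
    exact absurd (hy ▸ hx) (hb x)
  · rw [Function.update_of_ne hxa] at hx
    rw [Function.update_of_ne hya] at hy
    exact hπ x y c hx hy

/-- If an element of `A` is deleted and `|A| ≤ |B|`, then some element of `B` is inserted. -/
theorem exists_inserted_of_deleted {A B : Type*} [Fintype A] [Fintype B]
    (hcard : Fintype.card A ≤ Fintype.card B) {π : A → Option B} {a : A} (ha : π a = none) :
    ∃ b, ∀ a', π a' ≠ some b := by
  by_contra! h
  choose f hf using h
  have hinj : Function.Injective f := fun b b' hbb =>
    Option.some_injective _ (by rw [← hf b, ← hf b', hbb])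
  have hlt : Fintype.card B < Fintype.card A :=
    Fintype.card_lt_of_injective_of_notMem f hinj (b := a) (by
      rintro ⟨b, rfl⟩
      simp [hf b] at ha)
  omega

/-- Replacing a deletion and an insertion by a substitution does not increase the cost. -/
theorem ecaCost_update_some_le {A B : Type*} [Fintype A] [Fintype B] [DecidableEq A]
    [DecidableEq B] (csub : A → B → NNReal) (cdel : A → NNReal) (cins : B → NNReal)
    {π : A → Option B} {a : A} {b : B} (hq : csub a b ≤ cdel a + cins b)
    (ha : π a = none) (hb : ∀ a', π a' ≠ some b) :
    ecaCost csub cdel cins (Function.update π a (some b)) ≤ ecaCost csub cdel cins π := by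
  have hfilter : Finset.univ.filter (fun c => ∀ x, Function.update π a (some b) x ≠ some c) =
      (Finset.univ.filter (fun c => ∀ x, π x ≠ some c)).erase b := by
    ext c
    simp only [Finset.mem_filter, Finset.mem_univ, true_and, Finset.mem_erase]
    constructor
    · intro h
      refine ⟨fun hcb => h a (by simp [hcb]), fun x hx => ?_⟩
      have hxa : x ≠ a := by
        rintro rfl
        simp [ha] at hx
      exact h x (by rw [Function.update_of_ne hxa, hx])
    · rintro ⟨hcb, h⟩ x hx
      by_cases hxa : x = a
      · subst hxa
        exact hcb (by simpa using hx.symm)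
      · exact h x (by rwa [Function.update_of_ne hxa] at hx)
  have hsum : ∑ x ∈ Finset.univ.erase a,
        (Function.update π a (some b) x).elim (cdel x) (fun c => csub x c) =
      ∑ x ∈ Finset.univ.erase a, (π x).elim (cdel x) (fun c => csub x c) :=
    Finset.sum_congr rfl fun x hx => by
      rw [Function.update_of_ne (Finset.ne_of_mem_erase hx)]
  have hmem : b ∈ Finset.univ.filter (fun c => ∀ x, π x ≠ some c) := by simpa using hb
  unfold ecaCost
  rw [hfilter, ← Finset.add_sum_erase Finset.univ _ (Finset.mem_univ a), hsum,
    ← Finset.add_sum_erase Finset.univ (fun x => (π x).elim (cdel x) _) (Finset.mem_univ a),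
    ← Finset.add_sum_erase _ cins hmem]
  simp only [Function.update_self, Option.elim_some, ha, Option.elim_none]
  calc _ ≤ (cdel a + cins b) + _ + _ := by gcongr
    _ = _ := by ring

/-- If the costs satisfy the quasimetric condition
`csub a b ≤ cdel a + cins b` and `|A| ≤ |B|`, then for every error-correcting
assignment `π` between `A` and `B` there is an error-correcting assignment `π'`
that deletes no element of `A` and whose cost is at most that of `π`. -/
theorem eca_no_deletion_of_quasimetric {A B : Type*} [Fintype A] [Fintype B]
    [DecidableEq B] (csub : A → B → NNReal) (cdel : A → NNReal) (cins : B → NNReal)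
    (hq : ∀ a b, csub a b ≤ cdel a + cins b)
    (hcard : Fintype.card A ≤ Fintype.card B)
    (π : A → Option B) (hπ : IsECA π) :
    ∃ π' : A → Option B, IsECA π' ∧ (∀ a, π' a ≠ none) ∧
      ecaCost csub cdel cins π' ≤ ecaCost csub cdel cins π := by
  classical
  induction hn : (Finset.univ.filter fun a => π a = none).card using Nat.strong_induction_on
    generalizing π with
  | _ n ih =>
    by_cases hdel : ∀ a, π a ≠ none
    · exact ⟨π, hπ, hdel, le_rfl⟩
    push Not at hdel
    obtain ⟨a, ha⟩ := hdel
    obtain ⟨b, hb⟩ := exists_inserted_of_deleted hcard ha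
    have hlt : (Finset.univ.filter fun x => Function.update π a (some b) x = none).card < n := by
      rw [← hn]
      refine Finset.card_lt_card (Finset.ssubset_iff_of_subset ?_ |>.2 ⟨a, by simp [ha], by simp⟩)
      intro x hx
      by_cases hxa : x = a
      · simp [hxa, ha]
      · simpa [Function.update_of_ne hxa] using hx
    obtain ⟨π', hπ', hne, hle⟩ := ih _ hlt _ (hπ.update_some a hb) rfl
    exact ⟨π', hπ', hne, hle.trans (ecaCost_update_some_le csub cdel cins (hq a b) ha hb)⟩
end

section
/- Let A and B be finite nonempty sets with |A| ≤ |B|, and let c_sub : A × B → ℝ≥0, c_del : A → ℝ≥0, c_ins : B → ℝ≥0 satisfy c_sub(a,b) ≤ c_del(a) + c_ins(b) for all a ∈ A, b ∈ B. Then there exists an error-correcting assignment π between A and B of minimum cost (among all error-correcting assignments between A and B) such that π deletes no element of A and inserts exactly |B| − |A| elements of B. -/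
/-- An error-correcting assignment extends to an injection when `|A| ≤ |B|`. -/
theorem IsECA.exists_injective_extension {A B : Type*} [Fintype A] [Fintype B] [DecidableEq B]
    [Nonempty B] {σ : A → Option B} (hσ : IsECA σ) (hcard : Fintype.card A ≤ Fintype.card B) :
    ∃ f : A → B, Function.Injective f ∧ ∀ a b, σ a = some b → f a = b := by
  obtain ⟨b₀⟩ := ‹Nonempty B›
  let S : Finset A := Finset.univ.filter (fun a => (σ a).isSome)
  let g : A → B := fun a => (σ a).getD b₀
  have hg : ∀ a b, σ a = some b → g a = b := fun a b h => by simp [g, h]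
  have hinj : Set.InjOn g S := by
    intro a ha a' ha' h
    obtain ⟨b, hb⟩ := Option.isSome_iff_exists.1 (Finset.mem_filter.1 ha).2
    obtain ⟨b', hb'⟩ := Option.isSome_iff_exists.1 (Finset.mem_filter.1 ha').2
    rw [hg a b hb, hg a' b' hb'] at h
    exact hσ a a' b hb (h ▸ hb')
  obtain ⟨t, hSt, -, ht⟩ := Finset.exists_subsuperset_card_eq (Finset.subset_univ (S.image g))
    (Finset.card_image_le.trans (Finset.card_le_univ S)) hcard
  obtain ⟨e, he⟩ := Set.MapsTo.exists_equiv_extend_of_card_eq ht.symm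
    (fun a ha => hSt (Finset.mem_image_of_mem g ha)) hinj
  refine ⟨fun a => e a, Subtype.val_injective.comp e.injective, fun a b h => ?_⟩
  exact (he a (Finset.mem_coe.2 (by simp [S, h]))).trans (hg a b h)

/-- Extending an assignment to an injection does not increase its cost. -/
theorem ecaCost_some_le {A B : Type*} [Fintype A] [Fintype B] [DecidableEq B]
    {csub : A → B → NNReal} {cdel : A → NNReal} {cins : B → NNReal}
    (hq : ∀ a b, csub a b ≤ cdel a + cins b) {σ : A → Option B} {f : A → B}
    (hf : Function.Injective f) (hfσ : ∀ a b, σ a = some b → f a = b) :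
    ecaCost csub cdel cins (fun a => some (f a)) ≤ ecaCost csub cdel cins σ := by
  let D : Finset A := Finset.univ.filter (fun a => σ a = none)
  let U : Finset B := Finset.univ.filter (fun b => ∀ a, some (f a) ≠ some b)
  have hsub : ∑ a, csub a (f a) ≤
      ∑ a, (σ a).elim (cdel a) (csub a) + ∑ a ∈ D, cins (f a) := by
    rw [Finset.sum_filter, ← Finset.sum_add_distrib]
    refine Finset.sum_le_sum fun a _ => ?_
    cases h : σ a with
    | none => simpa using hq a (f a)
    | some b => simp [hfσ a b h]
  have hdisj : Disjoint (D.image f) U := by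
    rw [Finset.disjoint_left]
    intro b hb hbU
    obtain ⟨a, -, rfl⟩ := Finset.mem_image.1 hb
    exact (Finset.mem_filter.1 hbU).2 a rfl
  have hunion : D.image f ∪ U ⊆ Finset.univ.filter (fun b => ∀ a, σ a ≠ some b) := by
    intro b hb
    refine Finset.mem_filter.2 ⟨Finset.mem_univ b, fun a ha => ?_⟩
    rcases Finset.mem_union.1 hb with hb | hb
    · obtain ⟨a', ha', hab⟩ := Finset.mem_image.1 hb
      obtain rfl : a' = a := hf (hab.trans (hfσ a b ha).symm)
      simp [D, ha] at ha'
    · exact (Finset.mem_filter.1 hb).2 a (congrArg some (hfσ a b ha))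
  calc ecaCost csub cdel cins (fun a => some (f a))
      = ∑ a, csub a (f a) + ∑ b ∈ U, cins b := rfl
    _ ≤ ∑ a, (σ a).elim (cdel a) (csub a) + ∑ a ∈ D, cins (f a) + ∑ b ∈ U, cins b := by gcongr
    _ = ∑ a, (σ a).elim (cdel a) (csub a) + ∑ b ∈ D.image f ∪ U, cins b := by
        rw [Finset.sum_union hdisj, Finset.sum_image hf.injOn, add_assoc]
    _ ≤ ecaCost csub cdel cins σ :=
        add_le_add_right (Finset.sum_le_sum_of_subset hunion) _

/-- If `A` and `B` are finite nonempty sets with `|A| ≤ |B|` and the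
costs satisfy the quasimetric condition `csub a b ≤ cdel a + cins b`, then there is
a minimum-cost error-correcting assignment `π` between `A` and `B` that deletes no
element of `A` and inserts exactly `|B| - |A|` elements of `B`. -/
theorem eca_optimal_no_deletion {A B : Type*} [Fintype A] [Fintype B]
    [Nonempty A] [Nonempty B] [DecidableEq B]
    (csub : A → B → NNReal) (cdel : A → NNReal) (cins : B → NNReal)
    (hq : ∀ a b, csub a b ≤ cdel a + cins b)
    (hcard : Fintype.card A ≤ Fintype.card B) :
    ∃ π : A → Option B, IsECA π ∧
      (∀ σ : A → Option B, IsECA σ →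
        ecaCost csub cdel cins π ≤ ecaCost csub cdel cins σ) ∧
      (∀ a, π a ≠ none) ∧
      (Finset.univ.filter (fun b => ∀ a, π a ≠ some b)).card =
        Fintype.card B - Fintype.card A := by
  obtain ⟨e⟩ := Function.Embedding.nonempty_of_card_le hcard
  obtain ⟨f, hf, hmin⟩ := Set.exists_min_image {f : A → B | Function.Injective f}
    (fun f => ecaCost csub cdel cins (fun a => some (f a))) (Set.toFinite _) ⟨e, e.injective⟩
  refine ⟨fun a => some (f a), ?_, fun σ hσ => ?_, fun a => Option.some_ne_none _, ?_⟩
  · intro a a' b h h'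
    exact hf (Option.some_injective _ (h.trans h'.symm))
  · obtain ⟨g, hg, hgσ⟩ := hσ.exists_injective_extension hcard
    exact (hmin g hg).trans (ecaCost_some_le hq hg hgσ)
  · have h : Finset.univ.filter (fun b => ∀ a, some (f a) ≠ some b) =
        (Finset.univ.image f)ᶜ := by
      ext b
      simp
    rw [h, Finset.card_compl, Finset.card_image_of_injective _ hf, Finset.card_univ]
end

section
/- Let A and B be finite nonempty sets with |A| ≤ |B|, and let c_sub : A × B → ℝ≥0, c_del : A → ℝ≥0, c_ins : B → ℝ≥0 satisfy c_sub(a,b) ≤ c_del(a) + c_ins(b) for all a ∈ A, b ∈ B. Then the minimum cost over all error-correcting assignments between A and B equals the minimum, over all injective functions φ : A → B, of Σ_{a ∈ A} c_sub(a, φ(a)) + Σ_{b ∈ B \ φ(A)} c_ins(b). -/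
theorem ecaCost_some_comp {A B : Type*} [Fintype A] [Fintype B] [DecidableEq B]
    (csub : A → B → NNReal) (cdel : A → NNReal) (cins : B → NNReal) (φ : A ↪ B) :
    ecaCost csub cdel cins (fun a => some (φ a)) =
      (∑ a : A, csub a (φ a)) + ∑ b ∈ (Finset.univ.map φ)ᶜ, cins b := by
  unfold ecaCost
  congr 2
  ext b
  simp

/-- Every error-correcting assignment extends to an injection when `|A| ≤ |B|`. -/
theorem IsECA.exists_embedding {A B : Type*} [Fintype A] [Fintype B] [Nonempty B]
    [DecidableEq B] {π : A → Option B} (hπ : IsECA π)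
    (hcard : Fintype.card A ≤ Fintype.card B) :
    ∃ φ : A ↪ B, ∀ a b, π a = some b → φ a = b := by
  classical
  let f : A → B := fun a => (π a).getD (Classical.arbitrary B)
  let s : Finset A := Finset.univ.filter fun a => (π a).isSome
  have hf : ∀ a ∈ s, π a = some (f a) := by
    intro a ha
    obtain ⟨b, hb⟩ := Option.isSome_iff_exists.mp (Finset.mem_filter.mp ha).2
    simp [f, hb]
  have hinj : Set.InjOn f s := fun a ha a' ha' h =>
    hπ a a' (f a) (hf a ha) (h ▸ hf a' ha')
  obtain ⟨t, hst, -, ht⟩ := Finset.exists_subsuperset_card_eq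
    (Finset.subset_univ (s.image f)) (Finset.card_image_le.trans s.card_le_univ)
    (hcard.trans_eq Finset.card_univ.symm)
  obtain ⟨g, hg⟩ := Finset.exists_equiv_extend_of_card_eq ht.symm hst hinj
  refine ⟨g.toEmbedding.trans (Function.Embedding.subtype _), fun a b hab => ?_⟩
  have := hg a (by simp [s, hab])
  simpa [f, hab] using this

theorem cost_embedding_le_ecaCost {A B : Type*} [Fintype A] [Fintype B] [DecidableEq B]
    {csub : A → B → NNReal} {cdel : A → NNReal} {cins : B → NNReal}
    (hq : ∀ a b, csub a b ≤ cdel a + cins b) {π : A → Option B} {φ : A ↪ B}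
    (hφ : ∀ a b, π a = some b → φ a = b) :
    (∑ a : A, csub a (φ a)) + ∑ b ∈ (Finset.univ.map φ)ᶜ, cins b ≤
      ecaCost csub cdel cins π := by
  let D : Finset A := Finset.univ.filter fun a => π a = none
  have hsub : ∑ a : A, csub a (φ a) ≤
      (∑ a : A, (π a).elim (cdel a) (fun b => csub a b)) + ∑ b ∈ D.map φ, cins b := by
    rw [Finset.sum_map, Finset.sum_filter, ← Finset.sum_add_distrib]
    refine Finset.sum_le_sum fun a _ => ?_
    cases h : π a with
    | none => simpa using hq a (φ a)
    | some b => simp [hφ a b h]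
  have hdisj : Disjoint (D.map φ) (Finset.univ.map φ)ᶜ :=
    disjoint_compl_right.mono_left (Finset.map_subset_map.mpr (Finset.subset_univ D))
  have hins : ∑ b ∈ D.map φ, cins b + ∑ b ∈ (Finset.univ.map φ)ᶜ, cins b ≤
      ∑ b ∈ Finset.univ.filter (fun b => ∀ a, π a ≠ some b), cins b := by
    rw [← Finset.sum_union hdisj]
    refine Finset.sum_le_sum_of_subset fun b hb => ?_
    refine Finset.mem_filter.mpr ⟨Finset.mem_univ b, fun a ha => ?_⟩
    obtain rfl := hφ a b ha
    simp [D, ha] at hb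
  calc _ ≤ _ := add_le_add_left hsub _
    _ = _ := add_assoc _ _ _
    _ ≤ _ := add_le_add_right hins _

/-- If `A` and `B` are finite nonempty sets with `|A| ≤ |B|` and the
costs satisfy the quasimetric condition `csub a b ≤ cdel a + cins b`, then the
minimum cost over all error-correcting assignments between `A` and `B` equals the
minimum, over all injective functions `φ : A → B`, of
`∑ a, csub a (φ a) + ∑ b ∉ φ(A), cins b`. -/
theorem eca_min_eq_min_over_injections {A B : Type*} [Fintype A] [Fintype B]
    [Nonempty A] [Nonempty B] [DecidableEq B]
    (csub : A → B → NNReal) (cdel : A → NNReal) (cins : B → NNReal)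
    (hq : ∀ a b, csub a b ≤ cdel a + cins b)
    (hcard : Fintype.card A ≤ Fintype.card B) :
    (⨅ π : {π : A → Option B // IsECA π}, ecaCost csub cdel cins π.1) =
      ⨅ φ : A ↪ B, ((∑ a : A, csub a (φ a)) + ∑ b ∈ (Finset.univ.map φ)ᶜ, cins b) := by
  obtain ⟨φ₀⟩ := Function.Embedding.nonempty_of_card_le hcard
  have : Nonempty (A ↪ B) := ⟨φ₀⟩
  have hsome (φ : A ↪ B) : IsECA fun a => some (φ a) := fun a a' b h h' =>
    φ.injective (Option.some.inj (h.trans h'.symm))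
  have : Nonempty {π : A → Option B // IsECA π} := ⟨⟨_, hsome φ₀⟩⟩
  apply le_antisymm
  · refine le_ciInf fun φ => ?_
    rw [← ecaCost_some_comp csub cdel cins φ]
    exact ciInf_le (OrderBot.bddBelow _)
      (⟨_, hsome φ⟩ : {π : A → Option B // IsECA π})
  · refine le_ciInf fun π => ?_
    obtain ⟨φ, hφ⟩ := π.2.exists_embedding hcard
    exact (ciInf_le (OrderBot.bddBelow _) φ).trans (cost_embedding_le_ecaCost hq hφ)
end

section
/- Let L be a type with decidable equality, let n ≤ m be natural numbers, and let u : Fin n → L and v : Fin m → L be labeling functions. Then the maximum, over all injective functions φ : Fin n → Fin m, of the number of indices i ∈ Fin n with u(i) = v(φ(i)), equals the cardinality of the multiset intersection of the multiset {u(i) : i ∈ Fin n} and the multiset {v(k) : k ∈ Fin m}. -/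
/-- Greedy matching: there is a partial injection from `s` to `t`, preserving labels, whose domain
has as many elements as the multiset intersection of the labels. -/
theorem Finset.exists_injOn_label_agreement {α β L : Type*} [DecidableEq α] [DecidableEq β]
    [DecidableEq L] (f₀ : α → β) (u : α → L) (v : β → L) (s : Finset α) (t : Finset β) :
    ∃ s' ⊆ s, ∃ f : α → β, Set.InjOn f s' ∧ (∀ i ∈ s', f i ∈ t) ∧ (∀ i ∈ s', u i = v (f i)) ∧
      s'.card = Multiset.card (s.val.map u ∩ t.val.map v) := by
  induction s using Finset.induction generalizing t with
  | empty => exact ⟨∅, by simp, f₀, by simp⟩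
  | insert a s has ih =>
    rw [Finset.insert_val_of_notMem has, Multiset.map_cons]
    by_cases h : u a ∈ t.val.map v
    · obtain ⟨b, hb, hba⟩ := Multiset.mem_map.1 h
      obtain ⟨s', hs', f, hinj, hmaps, hlabel, hcard⟩ := ih (t.erase b)
      have has' : a ∉ s' := fun ha => has (hs' ha)
      have hne : ∀ i ∈ s', i ≠ a := fun i hi hia => has' (hia ▸ hi)
      have hupd : ∀ i ∈ s', Function.update f a b i = f i := fun i hi =>
        Function.update_of_ne (hne i hi) _ _
      refine ⟨insert a s', Finset.insert_subset_insert a hs', Function.update f a b, ?_, ?_, ?_, ?_⟩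
      · rw [Finset.coe_insert, Set.injOn_insert (by simpa using has')]
        refine ⟨hinj.congr fun i hi => (hupd i hi).symm, ?_⟩
        rintro ⟨i, hi, hib⟩
        rw [hupd i hi, Function.update_self] at hib
        exact Finset.ne_of_mem_erase (hmaps i hi) hib
      · intro i hi
        obtain rfl | hi := Finset.mem_insert.1 hi
        · simpa using hb
        · rw [hupd i hi]
          exact Finset.mem_of_mem_erase (hmaps i hi)
      · intro i hi
        obtain rfl | hi := Finset.mem_insert.1 hi
        · simp [hba]
        · rw [hupd i hi]
          exact hlabel i hi
      · rw [Multiset.cons_inter_of_pos _ h, Multiset.card_cons, Finset.card_insert_of_notMem has',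
          hcard, Finset.erase_val, Multiset.map_erase_of_mem _ _ hb, hba]
    · obtain ⟨s', hs', hf⟩ := ih t
      rw [Multiset.cons_inter_of_neg _ h]
      exact ⟨s', hs'.trans (Finset.subset_insert a s), hf⟩

/-- A partial injection between finite types extends to an embedding if the cardinalities
permit. -/
theorem Finset.exists_embedding_extend {α β : Type*} [Fintype α] [Fintype β] [DecidableEq β]
    (h : Fintype.card α ≤ Fintype.card β) {s : Finset α} {f : α → β} (hf : Set.InjOn f s) :
    ∃ φ : α ↪ β, ∀ i ∈ s, φ i = f i := by
  obtain ⟨t, hst, -, ht⟩ := Finset.exists_subsuperset_card_eq (Finset.subset_univ (s.image f))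
    (Finset.card_image_le.trans s.card_le_univ) h
  obtain ⟨g, hg⟩ := Finset.exists_equiv_extend_of_card_eq ht.symm hst hf
  exact ⟨g.toEmbedding.trans (Function.Embedding.subtype _), hg⟩

/-- An embedding agrees with the labels at no more points than the multiset intersection has. -/
theorem card_label_agreement_le_multiset_inter_card {α β L : Type*} [Fintype α] [Fintype β]
    [DecidableEq L] (u : α → L) (v : β → L) (φ : α ↪ β) :
    (Finset.univ.filter (fun i => u i = v (φ i))).card ≤
      Multiset.card (Finset.univ.val.map u ∩ Finset.univ.val.map v) := by
  set s := Finset.univ.filter (fun i => u i = v (φ i))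
  have hu : s.val.map u ≤ Finset.univ.val.map u :=
    Multiset.map_le_map (Finset.val_le_iff.2 s.subset_univ)
  have hv : s.val.map u ≤ Finset.univ.val.map v := by
    have : s.val.map u = (s.map φ).val.map v := by
      rw [Finset.map_val, Multiset.map_map]
      exact Multiset.map_congr rfl fun i hi => (Finset.mem_filter.1 hi).2
    rw [this]
    exact Multiset.map_le_map (Finset.val_le_iff.2 (Finset.subset_univ _))
  simpa using Multiset.card_le_card (Multiset.le_inter hu hv)

/-- For labeling functions `u : Fin n → L` and `v : Fin m → L` with
`n ≤ m`, the maximum, over all injective functions `φ : Fin n → Fin m`, of the number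
of indices `i` with `u i = v (φ i)`, equals the cardinality of the multiset
intersection of the multiset images of `u` and `v`. -/
theorem max_label_agreement_eq_multiset_inter_card {L : Type*} [DecidableEq L]
    {n m : ℕ} (hnm : n ≤ m) (u : Fin n → L) (v : Fin m → L) :
    (⨆ φ : Fin n ↪ Fin m, (Finset.univ.filter (fun i : Fin n => u i = v (φ i))).card) =
      Multiset.card ((Finset.univ.val.map u) ∩ (Finset.univ.val.map v)) := by
  have hle := card_label_agreement_le_multiset_inter_card u v
  have : Nonempty (Fin n ↪ Fin m) := ⟨Fin.castLEEmb hnm⟩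
  refine le_antisymm (ciSup_le hle) ?_
  obtain ⟨s, -, f, hinj, -, hlabel, hcard⟩ :=
    Finset.exists_injOn_label_agreement (Fin.castLE hnm) u v Finset.univ Finset.univ
  obtain ⟨φ, hφ⟩ := Finset.exists_embedding_extend (by simpa using hnm) hinj
  rw [← hcard]
  refine le_ciSup_of_le ⟨_, Set.forall_mem_range.2 hle⟩ φ (Finset.card_le_card fun i hi => ?_)
  simpa [hφ i hi] using hlabel i hi
end

section
/- Let L be a type with decidable equality, let n ≤ m be natural numbers with n ≥ 1, and let u : Fin n → L and v : Fin m → L be labeling functions. Let s, d, t ∈ ℝ≥0 be constants with s ≤ d + t, and define the costs of an error-correcting assignment between Fin n and Fin m by: substituting i by k costs 0 if u(i) = v(k) and s otherwise; deleting any i costs d; inserting any k costs t. Then the minimum cost over all error-correcting assignments between Fin n and Fin m equals t · (m − n) + s · (n − c), where c is the cardinality of the multiset intersection of the multiset {u(i) : i ∈ Fin n} and the multiset {v(k) : k ∈ Fin m}. -/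
/-- If a function takes a list's entries (in some order) as its values, then it is a
rearrangement of that list. -/
theorem exists_perm_getElem_of_map_univ_eq {L : Type*} {n : ℕ} (u : Fin n → L) (l : List L)
    (h : Finset.univ.val.map u = (l : Multiset L)) (hl : l.length = n) :
    ∃ e : Equiv.Perm (Fin n), ∀ i, u i = l[(e i : ℕ)]'(by have := (e i).2; omega) := by
  classical
  have hp : (List.ofFn u).Perm l := by
    rw [← Multiset.coe_eq_coe, ← h, Fin.univ_val_map]
  let g : Fin n → Fin n := fun i => (hp.subperm.idxInj (i.cast (by simp))).cast hl
  have hg : Function.Injective g := fun i j hij => by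
    simpa [g, List.Subperm.idxInj_inj] using hij
  refine ⟨Equiv.ofBijective g (Finite.injective_iff_bijective.1 hg), fun i => ?_⟩
  simp [g]

/-- There is an embedding that preserves at least as many labels as the multisets of labels
have in common. -/
theorem exists_embedding_card_inter_le {L : Type*} [DecidableEq L] {n m : ℕ}
    (hnm : n ≤ m) (u : Fin n → L) (v : Fin m → L) :
    ∃ f : Fin n ↪ Fin m,
      Multiset.card ((Finset.univ.val.map u) ∩ (Finset.univ.val.map v)) ≤
        (Finset.univ.filter fun i => u i = v (f i)).card := by
  set X := (Finset.univ.val.map u) ∩ (Finset.univ.val.map v) with hX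
  obtain ⟨U, hU⟩ := Multiset.le_iff_exists_add.1
    (show X ≤ Finset.univ.val.map u from Multiset.inter_le_left)
  obtain ⟨V, hV⟩ := Multiset.le_iff_exists_add.1
    (show X ≤ Finset.univ.val.map v from Multiset.inter_le_right)
  have hUn := congrArg Multiset.card hU
  have hVn := congrArg Multiset.card hV
  simp only [Multiset.card_map, Finset.card_val, Finset.card_univ, Fintype.card_fin,
    Multiset.card_add] at hUn hVn
  obtain ⟨e, he⟩ := exists_perm_getElem_of_map_univ_eq u (X.toList ++ U.toList)
    (by rw [hU, ← Multiset.coe_add, Multiset.coe_toList, Multiset.coe_toList]) (by simp [hUn])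
  obtain ⟨e', he'⟩ := exists_perm_getElem_of_map_univ_eq v (X.toList ++ V.toList)
    (by rw [hV, ← Multiset.coe_add, Multiset.coe_toList, Multiset.coe_toList]) (by simp [hVn])
  refine ⟨(e.toEmbedding.trans (Fin.castLEEmb hnm)).trans e'.symm.toEmbedding, ?_⟩
  let g : Fin (Multiset.card X) ↪ Fin n :=
    (Fin.castLEEmb (by omega)).trans e.symm.toEmbedding
  calc Multiset.card X = (Finset.univ.map g).card := by simp
    _ ≤ _ := Finset.card_le_card fun i hi => by
      obtain ⟨k, -, rfl⟩ := Finset.mem_map.1 hi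
      simp [he, he', g]

/-- An error-correcting assignment preserves at most as many labels as the multisets of labels
have in common. -/
theorem IsECA.card_label_eq_le {A B L : Type*} [Fintype A] [Fintype B] [DecidableEq L]
    {π : A → Option B} (hπ : IsECA π) (u : A → L) (v : B → L) :
    (Finset.univ.filter fun a => ∃ b, π a = some b ∧ u a = v b).card ≤
      Multiset.card ((Finset.univ.val.map u) ∩ (Finset.univ.val.map v)) := by
  classical
  set S := Finset.univ.filter fun a => ∃ b, π a = some b ∧ u a = v b with hS
  have hb : ∀ a : S, ∃ b, π a = some b ∧ u a = v b := fun a => (Finset.mem_filter.1 a.2).2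
  choose f hf hfu using hb
  let g : S ↪ B := ⟨f, fun a a' h => Subtype.ext (hπ a a' (f a) (hf a) (h ▸ hf a'))⟩
  have h₁ : S.val.map u ≤ Finset.univ.val.map u :=
    Multiset.map_le_map (Finset.val_le_iff.2 (Finset.subset_univ S))
  have h₂ : S.val.map u ≤ Finset.univ.val.map v := by
    have : S.val.map u = (S.attach.map g).val.map v := by
      rw [Finset.map_val, Multiset.map_map, Finset.attach_val]
      conv_lhs => rw [← Multiset.attach_map_val S.val, Multiset.map_map]
      exact Multiset.map_congr rfl fun a _ => hfu a
    rw [this]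
    exact Multiset.map_le_map (Finset.val_le_iff.2 (Finset.subset_univ _))
  simpa using Multiset.card_le_card (Multiset.le_inter h₁ h₂)

/-- The number of inserted elements plus the number of substituted elements is the size of the
target set. -/
theorem IsECA.card_inserted_add {A B : Type*} [Fintype A] [Fintype B] [DecidableEq B]
    {π : A → Option B} (hπ : IsECA π) :
    (Finset.univ.filter fun b => ∀ a, π a ≠ some b).card + Fintype.card A =
      Fintype.card B + (Finset.univ.filter fun a => π a = none).card := by
  have hsub : (Finset.univ.filter fun b => ¬ ∀ a, π a ≠ some b).card =
      (Finset.univ.filter fun a => ¬ π a = none).card := by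
    symm
    refine Finset.card_bij
      (fun a ha => (π a).get (Option.isSome_iff_ne_none.2 (Finset.mem_filter.1 ha).2)) ?_ ?_ ?_
    · intro a ha
      simp only [Finset.mem_filter, Finset.mem_univ, true_and, not_forall, not_not]
      exact ⟨a, by simp⟩
    · intro a ha a' ha' h
      exact hπ a a' _ (Option.some_get _).symm (by rw [h]; simp)
    · intro b hb
      simp only [Finset.mem_filter, Finset.mem_univ, true_and, not_forall, not_not] at hb
      obtain ⟨a, ha⟩ := hb
      exact ⟨a, by simp [ha], by simp [ha]⟩
  have h₁ := Finset.card_filter_add_card_filter_not (s := (Finset.univ : Finset B))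
    (fun b => ∀ a, π a ≠ some b)
  have h₂ := Finset.card_filter_add_card_filter_not (s := (Finset.univ : Finset A))
    (fun a => π a = none)
  rw [Finset.card_univ] at h₁ h₂
  omega

/-- The cost under constant edit costs, expressed through the numbers of deleted, relabeled and
inserted elements. -/
theorem ecaCost_const {A B L : Type*} [Fintype A] [Fintype B] [DecidableEq B] [DecidableEq L]
    (π : A → Option B) (u : A → L) (v : B → L) (s d t : NNReal) :
    ecaCost (fun a b => if u a = v b then 0 else s) (fun _ => d) (fun _ => t) π =
      d * ((Finset.univ.filter fun a => π a = none).card : NNReal) +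
      s * ((Finset.univ.filter fun a => ∃ b, π a = some b ∧ u a ≠ v b).card : NNReal) +
      t * ((Finset.univ.filter fun b => ∀ a, π a ≠ some b).card : NNReal) := by
  unfold ecaCost
  congr 1
  · rw [Finset.card_filter, Finset.card_filter]
    push_cast
    rw [Finset.mul_sum, Finset.mul_sum, ← Finset.sum_add_distrib]
    refine Finset.sum_congr rfl fun a _ => ?_
    cases h : π a <;> simp
  · simp [mul_comm]

/-- Every source element is deleted, preserved, or relabeled. -/
theorem card_deleted_add_card_preserved_add_card_relabeled {A B L : Type*} [Fintype A]
    [Fintype B] [DecidableEq B] [DecidableEq L] (π : A → Option B) (u : A → L) (v : B → L) :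
    (Finset.univ.filter fun a => π a = none).card +
      (Finset.univ.filter fun a => ∃ b, π a = some b ∧ u a = v b).card +
      (Finset.univ.filter fun a => ∃ b, π a = some b ∧ u a ≠ v b).card = Fintype.card A := by
  rw [Finset.card_filter, Finset.card_filter, Finset.card_filter, ← Finset.sum_add_distrib,
    ← Finset.sum_add_distrib, ← Finset.card_univ, Finset.card_eq_sum_ones]
  refine Finset.sum_congr rfl fun a _ => ?_
  cases h : π a with
  | none => simp
  | some b => by_cases hb : u a = v b <;> simp [hb]

/-- Lower bound on the cost of an error-correcting assignment under constant edit costs. -/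
theorem IsECA.le_ecaCost_const {A B L : Type*} [Fintype A] [Fintype B] [DecidableEq B]
    [DecidableEq L] {π : A → Option B} (hπ : IsECA π) (hAB : Fintype.card A ≤ Fintype.card B)
    (u : A → L) (v : B → L) {s d t : NNReal} (hq : s ≤ d + t) :
    t * ((Fintype.card B - Fintype.card A : ℕ) : NNReal) +
        s * ((Fintype.card A -
          Multiset.card ((Finset.univ.val.map u) ∩ (Finset.univ.val.map v)) : ℕ) : NNReal) ≤
      ecaCost (fun a b => if u a = v b then 0 else s) (fun _ => d) (fun _ => t) π := by
  rw [ecaCost_const]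
  have hi := hπ.card_inserted_add
  have hp := card_deleted_add_card_preserved_add_card_relabeled π u v
  have hc := hπ.card_label_eq_le u v
  set D := (Finset.univ.filter fun a => π a = none).card
  set R := (Finset.univ.filter fun a => ∃ b, π a = some b ∧ u a ≠ v b).card
  set I := (Finset.univ.filter fun b => ∀ a, π a ≠ some b).card
  have hI : I = (Fintype.card B - Fintype.card A) + D := by omega
  set k := Fintype.card B - Fintype.card A
  calc _ ≤ t * (k : NNReal) + s * ((D + R : ℕ) : NNReal) := by
        gcongr; omega
    _ = t * (k : NNReal) + s * D + s * R := by push_cast; ring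
    _ ≤ t * (k : NNReal) + (d + t) * D + s * R := by gcongr
    _ = _ := by rw [hI]; push_cast; ring

/-- For labeling functions `u : Fin n → L` and `v : Fin m → L` with
`1 ≤ n ≤ m`, and constants `s ≤ d + t`, with substitution cost `0` for equal labels
and `s` otherwise, deletion cost `d`, and insertion cost `t`, the minimum cost over
all error-correcting assignments between `Fin n` and `Fin m` equals
`t * (m - n) + s * (n - c)`, where `c` is the cardinality of the multiset
intersection of the multiset images of `u` and `v`. -/
theorem eca_min_cost_constant_costs {L : Type*} [DecidableEq L] {n m : ℕ}
    (hn : 1 ≤ n) (hnm : n ≤ m) (u : Fin n → L) (v : Fin m → L)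
    (s d t : NNReal) (hq : s ≤ d + t) :
    (⨅ π : {π : Fin n → Option (Fin m) // IsECA π},
        ecaCost (fun i k => if u i = v k then 0 else s) (fun _ => d) (fun _ => t) π.1) =
      t * ((m - n : ℕ) : NNReal) +
        s * ((n - Multiset.card ((Finset.univ.val.map u) ∩ (Finset.univ.val.map v)) : ℕ) :
          NNReal) := by
  apply le_antisymm
  · obtain ⟨f, hf⟩ := exists_embedding_card_inter_le hnm u v
    have hπ : IsECA fun i => some (f i) := fun a a' b h h' =>
      f.injective (Option.some_injective _ (h.trans h'.symm))
    refine (ciInf_le (OrderBot.bddBelow _) ⟨_, hπ⟩).trans ?_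
    rw [ecaCost_const]
    have hi := hπ.card_inserted_add
    have hp := card_deleted_add_card_preserved_add_card_relabeled (fun i => some (f i)) u v
    simp only [Fintype.card_fin, reduceCtorEq, Finset.filter_false, Finset.card_empty,
      Nat.cast_zero, mul_zero, zero_add, Option.some.injEq, exists_eq_left', ne_eq] at hi hp ⊢
    rw [add_comm]
    gcongr <;> omega
  · have : Nonempty {π : Fin n → Option (Fin m) // IsECA π} :=
      ⟨⟨fun _ => none, fun _ _ _ h => by simp at h⟩⟩
    refine le_ciInf fun π => ?_
    simpa using π.2.le_ecaCost_const (by simpa using hnm) u v hq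
end
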